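/- arXiv:2605.18021 — 2 statements merged into one kernel-verified Lean document; each statement's English description precedes it below -/
import Mathlib

section
/- There exists a constant C > 0, depending only on d and φ, such that for every integer N ≥ 0: (a) for every ξ ∈ ℝ^d, ∫_{ℝ^d} |M_N(ξ,η)| dη ≤ C, and (b) for every η ∈ ℝ^d, ∫_{ℝ^d} |M_N(ξ,η)| dξ ≤ C. -/
open MeasureTheory Metric
open scoped RealInnerProductSpace Pointwise ENNReal NNReal Convolution

/-- The Fourier transform `𝓕f(ξ) = (2π)^{-d/2} ∫ f(x) e^{-i⟨x,ξ⟩} dx` on `ℝ^d`. -/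
noncomputable def fourierInt {d : ℕ} (f : EuclideanSpace ℝ (Fin d) → ℂ)
    (ξ : EuclideanSpace ℝ (Fin d)) : ℂ :=
  (((2 * Real.pi) ^ (-(d : ℝ) / 2) : ℝ) : ℂ) *
    ∫ x, f x * Complex.exp (-Complex.I * ((⟪x, ξ⟫ : ℝ) : ℂ))

/-- The dilations `φ_j(x) = 2^{jd} φ(2^j x)`. -/
noncomputable def phij {d : ℕ} (φ : EuclideanSpace ℝ (Fin d) → ℂ) (j : ℕ) :
    EuclideanSpace ℝ (Fin d) → ℂ :=
  fun x => (2 : ℂ) ^ (j * d) * φ ((2 : ℝ) ^ j • x)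

/-- `ψ_0 = 𝓕φ` and `ψ_j = 𝓕φ_j - 𝓕φ_{j-1}` for `j ≥ 1`. -/
noncomputable def psij {d : ℕ} (φ : EuclideanSpace ℝ (Fin d) → ℂ) (j : ℕ) :
    EuclideanSpace ℝ (Fin d) → ℂ :=
  fun ξ => if j = 0 then fourierInt φ ξ
    else fourierInt (phij φ j) ξ - fourierInt (phij φ (j - 1)) ξ

/-- The kernel `M_N(ξ,η) = ∑_{j=0}^N (φ_j - φ_{j-1})(η-ξ) (1 - 𝓕φ_j(η))`,
with the convention `φ_{-1} := 0`. -/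
noncomputable def MN {d : ℕ} (φ : EuclideanSpace ℝ (Fin d) → ℂ) (N : ℕ)
    (ξ η : EuclideanSpace ℝ (Fin d)) : ℂ :=
  ∑ j ∈ Finset.range (N + 1),
    (phij φ j (η - ξ) - (if j = 0 then 0 else phij φ (j - 1) (η - ξ))) *
      (1 - fourierInt (phij φ j) η)

/-- A dilation by `2 ^ j` of the function turns into a dilation by `2⁻ʲ` of the transform. -/
lemma fourierInt_phij {d : ℕ} (f : EuclideanSpace ℝ (Fin d) → ℂ) (j : ℕ)
    (ξ : EuclideanSpace ℝ (Fin d)) :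
    fourierInt (phij f j) ξ = fourierInt f (((2 : ℝ) ^ j)⁻¹ • ξ) := by
  unfold fourierInt
  congr 1
  have hpos : (0 : ℝ) < 2 ^ j := by positivity
  have h := Measure.integral_comp_smul (volume : Measure (EuclideanSpace ℝ (Fin d)))
    (fun x => f x * Complex.exp (-Complex.I * ((⟪x, ((2 : ℝ) ^ j)⁻¹ • ξ⟫ : ℝ) : ℂ))) ((2 : ℝ) ^ j)
  have h2 : ∀ x : EuclideanSpace ℝ (Fin d),
      (⟪(2 : ℝ) ^ j • x, ((2 : ℝ) ^ j)⁻¹ • ξ⟫ : ℝ) = ⟪x, ξ⟫ := by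
    intro x
    rw [real_inner_smul_left, real_inner_smul_right]
    field_simp
  simp only [h2, finrank_euclideanSpace, Fintype.card_fin] at h
  simp only [phij, mul_assoc]
  rw [integral_const_mul, h, abs_of_nonneg (by positivity), Complex.real_smul, ← mul_assoc]
  push_cast
  rw [← pow_mul, mul_inv_cancel₀ (pow_ne_zero _ two_ne_zero), one_mul]

/-- Summation by parts for the kernel. -/
lemma MN_eq_sum_by_parts {d : ℕ} (φ : EuclideanSpace ℝ (Fin d) → ℂ) (N : ℕ)
    (ξ η : EuclideanSpace ℝ (Fin d)) :
    MN φ N ξ η =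
      ∑ j ∈ Finset.range N, phij φ j (η - ξ) *
        (fourierInt (phij φ (j + 1)) η - fourierInt (phij φ j) η) +
      phij φ N (η - ξ) * (1 - fourierInt (phij φ N) η) := by
  induction N with
  | zero => simp [MN]
  | succ N ih =>
    have h : MN φ (N + 1) ξ η = MN φ N ξ η +
        (phij φ (N + 1) (η - ξ) - phij φ N (η - ξ)) * (1 - fourierInt (phij φ (N + 1)) η) := by
      simp [MN, Finset.sum_range_succ _ (N + 1)]
    rw [h, ih, Finset.sum_range_succ]
    ring

/-- The indicator of the dyadic shell `2 ^ j ≤ 2 t ≤ 2 ^ (j + 4)`. -/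
noncomputable def dyadicShell (j : ℕ) (t : ℝ) : ℝ :=
  open Classical in if (2 : ℝ) ^ j ≤ 2 * t ∧ 2 * t ≤ 2 ^ (j + 4) then 1 else 0

lemma dyadicShell_nonneg (j : ℕ) (t : ℝ) : 0 ≤ dyadicShell j t := by
  unfold dyadicShell; split_ifs <;> norm_num

lemma sum_dyadicShell_le (N : ℕ) (t : ℝ) : ∑ j ∈ Finset.range N, dyadicShell j t ≤ 5 := by
  classical
  set S := (Finset.range N).filter fun j => (2 : ℝ) ^ j ≤ 2 * t ∧ 2 * t ≤ 2 ^ (j + 4) with hS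
  have h : ∑ j ∈ Finset.range N, dyadicShell j t = (S.card : ℝ) := by
    simp only [dyadicShell, hS, Finset.card_filter]
    push_cast
    exact Finset.sum_congr rfl fun j _ => by congr
  rw [h]
  rcases S.eq_empty_or_nonempty with he | hne
  · simp [he]
  · have hsub : S ⊆ Finset.Icc (S.min' hne) (S.min' hne + 4) := by
      intro j hj
      refine Finset.mem_Icc.2 ⟨S.min'_le j hj, ?_⟩
      have h1 := (Finset.mem_filter.1 hj).2.1
      have h2 := (Finset.mem_filter.1 (S.min'_mem hne)).2.2
      exact (pow_le_pow_iff_right₀ (by norm_num : (1 : ℝ) < 2)).1 (h1.trans h2)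
    have := Finset.card_le_card hsub
    rw [Nat.card_Icc] at this
    have h5 : S.card ≤ 5 := by omega
    exact_mod_cast h5

/-- The function dominating the kernel, as a function of `η - ξ`. -/
noncomputable def kernelMajorant {d : ℕ} (φ : EuclideanSpace ℝ (Fin d) → ℂ) (c : ℕ → ℝ) (N : ℕ)
    (y : EuclideanSpace ℝ (Fin d)) : ℝ :=
  ∑ j ∈ Finset.range N, (2 * c j * ‖phij φ j y‖ +
    4 * (1 / 2) ^ j * (‖(2 : ℝ) ^ j • y‖ * ‖phij φ j y‖)) + 2 * ‖phij φ N y‖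

section Dilation

variable {d : ℕ} (φ : EuclideanSpace ℝ (Fin d) → ℂ) (w : EuclideanSpace ℝ (Fin d) → ℝ) (j : ℕ)

lemma weighted_norm_phij (y : EuclideanSpace ℝ (Fin d)) :
    w ((2 : ℝ) ^ j • y) * ‖phij φ j y‖ =
      (2 : ℝ) ^ (j * d) * (fun x => w x * ‖φ x‖) ((2 : ℝ) ^ j • y) := by
  simp only [phij, norm_mul, norm_pow, Complex.norm_ofNat]
  ring

lemma integrable_weighted_phij (h : Integrable fun x => w x * ‖φ x‖) :
    Integrable fun y => w ((2 : ℝ) ^ j • y) * ‖phij φ j y‖ := by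
  simp only [weighted_norm_phij]
  exact (h.comp_smul (by positivity)).const_mul _

lemma integral_weighted_phij :
    ∫ y, w ((2 : ℝ) ^ j • y) * ‖phij φ j y‖ = ∫ x, w x * ‖φ x‖ := by
  simp only [weighted_norm_phij]
  rw [integral_const_mul, Measure.integral_comp_smul volume (fun x => w x * ‖φ x‖), abs_of_nonneg (by positivity),
    finrank_euclideanSpace, Fintype.card_fin, smul_eq_mul, ← mul_assoc, ← pow_mul,
    mul_inv_cancel₀ (by positivity), one_mul]

end Dilation

lemma sum_half_pow_le (N : ℕ) : ∑ j ∈ Finset.range N, ((1 : ℝ) / 2) ^ j ≤ 2 :=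
  sum_geometric_two_le N

lemma lintegral_kernelMajorant_le {d : ℕ} (φ : SchwartzMap (EuclideanSpace ℝ (Fin d)) ℂ)
    {c : ℕ → ℝ} {N : ℕ} (hc0 : ∀ j, 0 ≤ c j) (hc : ∑ j ∈ Finset.range N, c j ≤ 5) :
    ∫⁻ y, ENNReal.ofReal (kernelMajorant φ c N y) ≤
      ENNReal.ofReal (12 * (∫ x, ‖φ x‖) + 8 * (∫ x, ‖x‖ * ‖φ x‖) + 1) := by
  have hi1 : Integrable fun x => (fun _ => (1 : ℝ)) x * ‖φ x‖ := by
    simpa using φ.integrable.norm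
  have hi2 : Integrable fun x => ‖x‖ * ‖φ x‖ := by
    simpa using φ.integrable_pow_mul volume 1
  have hP : ∀ j, Integrable fun y => ‖phij φ j y‖ := fun j => by
    simpa using integrable_weighted_phij φ _ j hi1
  have hQ : ∀ j, Integrable fun y => ‖(2 : ℝ) ^ j • y‖ * ‖phij φ j y‖ := fun j =>
    integrable_weighted_phij φ (fun x => ‖x‖) j hi2
  have hPi : ∀ j, ∫ y, ‖phij φ j y‖ = ∫ x, ‖φ x‖ := fun j => by
    simpa using integral_weighted_phij φ (fun _ => 1) j
  have hQi : ∀ j, ∫ y, ‖(2 : ℝ) ^ j • y‖ * ‖phij φ j y‖ = ∫ x, ‖x‖ * ‖φ x‖ := fun j =>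
    integral_weighted_phij φ (fun x => ‖x‖) j
  have hterm : ∀ j ∈ Finset.range N, Integrable fun y => 2 * c j * ‖phij φ j y‖ +
      4 * (1 / 2) ^ j * (‖(2 : ℝ) ^ j • y‖ * ‖phij φ j y‖) := fun j _ =>
    ((hP j).const_mul _).add ((hQ j).const_mul _)
  have hint : Integrable (kernelMajorant φ c N) :=
    (integrable_finsetSum _ hterm).add ((hP N).const_mul 2)
  have hnn : ∀ y, 0 ≤ kernelMajorant φ c N y := fun y =>
    add_nonneg (Finset.sum_nonneg fun j _ => by have := hc0 j; positivity) (by positivity)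
  rw [← ofReal_integral_eq_lintegral_ofReal hint (Filter.Eventually.of_forall hnn)]
  apply ENNReal.ofReal_le_ofReal
  have hval : ∫ y, kernelMajorant φ c N y =
      2 * (∑ j ∈ Finset.range N, c j) * (∫ x, ‖φ x‖) +
      4 * (∑ j ∈ Finset.range N, ((1 : ℝ) / 2) ^ j) * (∫ x, ‖x‖ * ‖φ x‖) +
      2 * ∫ x, ‖φ x‖ := by
    unfold kernelMajorant
    rw [integral_add (integrable_finsetSum _ hterm) ((hP N).const_mul 2),
      integral_finsetSum _ hterm, integral_const_mul, hPi]
    congr 1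
    rw [Finset.mul_sum, Finset.mul_sum, Finset.sum_mul, Finset.sum_mul, ← Finset.sum_add_distrib]
    refine Finset.sum_congr rfl fun j _ => ?_
    rw [integral_add ((hP j).const_mul _) ((hQ j).const_mul _), integral_const_mul,
      integral_const_mul, hPi, hQi]
  have hI : 0 ≤ ∫ x, ‖φ x‖ := integral_nonneg fun _ => norm_nonneg _
  have hJ : 0 ≤ ∫ x, ‖x‖ * ‖φ x‖ := integral_nonneg fun _ => by positivity
  rw [hval]
  nlinarith [mul_le_mul_of_nonneg_right hc hI,
    mul_le_mul_of_nonneg_right (sum_half_pow_le N) hJ]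

section Pointwise

variable {d : ℕ} {φ : EuclideanSpace ℝ (Fin d) → ℂ}

lemma norm_MN_le_kernelMajorant {c : ℕ → ℝ} {N : ℕ} {ξ η : EuclideanSpace ℝ (Fin d)}
    (hnorm : ∀ ξ, ‖fourierInt φ ξ‖ ≤ 1)
    (hc : ∀ j, fourierInt (phij φ (j + 1)) η ≠ fourierInt (phij φ j) η →
      1 ≤ c j + 2 * (1 / 2) ^ j * ‖(2 : ℝ) ^ j • (η - ξ)‖) (hc0 : ∀ j, 0 ≤ c j) :
    ‖MN φ N ξ η‖ ≤ kernelMajorant φ c N (η - ξ) := by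
  have hn : ∀ j, ‖fourierInt (phij φ j) η‖ ≤ 1 := fun j => by
    rw [fourierInt_phij]; exact hnorm _
  rw [MN_eq_sum_by_parts, kernelMajorant]
  refine (norm_add_le _ _).trans (add_le_add ((norm_sum_le _ _).trans
    (Finset.sum_le_sum fun j _ => ?_)) ?_)
  · rw [norm_mul]
    by_cases h : fourierInt (phij φ (j + 1)) η = fourierInt (phij φ j) η
    · have := hc0 j
      rw [h, sub_self, norm_zero, mul_zero]
      positivity
    · have h2 : ‖fourierInt (phij φ (j + 1)) η - fourierInt (phij φ j) η‖ ≤ 2 :=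
        (norm_sub_le _ _).trans (by linarith [hn j, hn (j + 1)])
      nlinarith [mul_le_mul_of_nonneg_left h2 (norm_nonneg (phij φ j (η - ξ))),
        mul_le_mul_of_nonneg_left (hc j h) (norm_nonneg (phij φ j (η - ξ)))]
  · have h2 : ‖1 - fourierInt (phij φ N) η‖ ≤ 2 :=
      (norm_sub_le _ _).trans (by rw [norm_one]; linarith [hn N])
    rw [norm_mul, mul_comm]
    gcongr

lemma norm_mem_of_fourierInt_phij_ne
    (hsupp : ∀ ξ : EuclideanSpace ℝ (Fin d), 2 < ‖ξ‖ → fourierInt φ ξ = 0)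
    (hone : ∀ ξ : EuclideanSpace ℝ (Fin d), ‖ξ‖ ≤ 1 → fourierInt φ ξ = 1)
    {j : ℕ} {η : EuclideanSpace ℝ (Fin d)}
    (h : fourierInt (phij φ (j + 1)) η ≠ fourierInt (phij φ j) η) :
    (2 : ℝ) ^ j ≤ ‖η‖ ∧ ‖η‖ ≤ 4 * 2 ^ j := by
  have hn : ∀ k : ℕ, ‖((2 : ℝ) ^ k)⁻¹ • η‖ = ‖η‖ / 2 ^ k := fun k => by
    rw [norm_smul, norm_inv, norm_pow, Real.norm_ofNat, inv_mul_eq_div]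
  have hpos : (0 : ℝ) < 2 ^ j := by positivity
  simp only [fourierInt_phij] at h
  by_contra hcon
  rw [not_and_or, not_le, not_le] at hcon
  apply h
  rcases hcon with hlt | hlt
  · rw [hone _ (by rw [hn, div_le_one (by positivity), pow_succ]; linarith),
      hone _ (by rw [hn, div_le_one hpos]; exact hlt.le)]
  · rw [hsupp _ (by rw [hn, lt_div_iff₀ (by positivity), pow_succ]; linarith),
      hsupp _ (by rw [hn, lt_div_iff₀ hpos]; linarith)]

lemma one_le_dyadicShell_add {j : ℕ} {ξ η : EuclideanSpace ℝ (Fin d)}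
    (h1 : (2 : ℝ) ^ j ≤ ‖η‖) (h2 : ‖η‖ ≤ 4 * 2 ^ j) :
    1 ≤ dyadicShell j ‖ξ‖ + 2 * (1 / 2) ^ j * ‖(2 : ℝ) ^ j • (η - ξ)‖ := by
  have hj : (1 : ℝ) ≤ 2 ^ j := one_le_pow₀ (by norm_num)
  have he : 2 * (1 / 2 : ℝ) ^ j * ‖(2 : ℝ) ^ j • (η - ξ)‖ = 2 * ‖η - ξ‖ := by
    rw [norm_smul, norm_pow, Real.norm_ofNat, one_div, inv_pow]
    field_simp
  rw [he]
  have hp : (2 : ℝ) ^ (j + 4) = 16 * 2 ^ j := by ring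
  unfold dyadicShell
  split_ifs with h
  · linarith [norm_nonneg (η - ξ)]
  · rw [not_and_or, not_le, not_le, hp] at h
    rcases h with h | h
    · linarith [norm_sub_norm_le η ξ]
    · linarith [norm_sub_norm_le ξ η, norm_sub_rev ξ η]

lemma one_le_dyadicShell_add_self {j : ℕ} {ξ η : EuclideanSpace ℝ (Fin d)}
    (h1 : (2 : ℝ) ^ j ≤ ‖η‖) (h2 : ‖η‖ ≤ 4 * 2 ^ j) :
    1 ≤ dyadicShell j ‖η‖ + 2 * (1 / 2) ^ j * ‖(2 : ℝ) ^ j • (η - ξ)‖ := by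
  have h := one_le_dyadicShell_add (ξ := η) h1 h2
  rw [sub_self, smul_zero, norm_zero, mul_zero, add_zero] at h
  exact le_add_of_le_of_nonneg h (by positivity)

end Pointwise

/-- There is `C > 0` depending only on `d` and `φ` such that for every
`N ≥ 0`: (a) `∫ |M_N(ξ,η)| dη ≤ C` for every `ξ`, and (b) `∫ |M_N(ξ,η)| dξ ≤ C`
for every `η`. -/
theorem stmt9 {d : ℕ} (φ : SchwartzMap (EuclideanSpace ℝ (Fin d)) ℂ)
    (hrad : ∀ x y : EuclideanSpace ℝ (Fin d), ‖x‖ = ‖y‖ → φ x = φ y)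
    (him : ∀ ξ, (fourierInt (⇑φ) ξ).im = 0)
    (hre : ∀ ξ, 0 ≤ (fourierInt (⇑φ) ξ).re ∧ (fourierInt (⇑φ) ξ).re ≤ 1)
    (hsupp : ∀ ξ : EuclideanSpace ℝ (Fin d), 2 < ‖ξ‖ → fourierInt (⇑φ) ξ = 0)
    (hone : ∀ ξ : EuclideanSpace ℝ (Fin d), ‖ξ‖ ≤ 1 → fourierInt (⇑φ) ξ = 1)
    :
    ∃ C : ℝ, 0 < C ∧ ∀ N : ℕ,
      (∀ ξ : EuclideanSpace ℝ (Fin d),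
        ∫⁻ η, (‖MN (⇑φ) N ξ η‖₊ : ℝ≥0∞) ≤ ENNReal.ofReal C) ∧
      (∀ η : EuclideanSpace ℝ (Fin d),
        ∫⁻ ξ, (‖MN (⇑φ) N ξ η‖₊ : ℝ≥0∞) ≤ ENNReal.ofReal C) := by
  have hnorm : ∀ ξ, ‖fourierInt (⇑φ) ξ‖ ≤ 1 := fun ξ => by
    rw [← Complex.abs_re_eq_norm.2 (him ξ), abs_of_nonneg (hre ξ).1]
    exact (hre ξ).2
  have hI : 0 ≤ ∫ x, ‖φ x‖ := integral_nonneg fun _ => norm_nonneg _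
  have hJ : 0 ≤ ∫ x, ‖x‖ * ‖φ x‖ := integral_nonneg fun _ => by positivity
  refine ⟨12 * (∫ x, ‖φ x‖) + 8 * (∫ x, ‖x‖ * ‖φ x‖) + 1, by positivity,
    fun N => ⟨fun ξ => ?_, fun η => ?_⟩⟩
  · have hle : ∀ η, (‖MN (⇑φ) N ξ η‖₊ : ℝ≥0∞) ≤
        ENNReal.ofReal (kernelMajorant φ (fun j => dyadicShell j ‖ξ‖) N (η - ξ)) := fun η => by
      rw [← enorm_eq_nnnorm, ← ofReal_norm]
      refine ENNReal.ofReal_le_ofReal (norm_MN_le_kernelMajorant hnorm (fun j h => ?_)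
        fun j => dyadicShell_nonneg j _)
      obtain ⟨h1, h2⟩ := norm_mem_of_fourierInt_phij_ne hsupp hone h
      exact one_le_dyadicShell_add h1 h2
    refine (lintegral_mono hle).trans ?_
    rw [lintegral_sub_right_eq_self fun y =>
      ENNReal.ofReal (kernelMajorant φ (fun j => dyadicShell j ‖ξ‖) N y)]
    exact lintegral_kernelMajorant_le φ (fun j => dyadicShell_nonneg j _) (sum_dyadicShell_le N _)
  · have hle : ∀ ξ, (‖MN (⇑φ) N ξ η‖₊ : ℝ≥0∞) ≤
        ENNReal.ofReal (kernelMajorant φ (fun j => dyadicShell j ‖η‖) N (η - ξ)) := fun ξ => by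
      rw [← enorm_eq_nnnorm, ← ofReal_norm]
      refine ENNReal.ofReal_le_ofReal (norm_MN_le_kernelMajorant hnorm (fun j h => ?_)
        fun j => dyadicShell_nonneg j _)
      obtain ⟨h1, h2⟩ := norm_mem_of_fourierInt_phij_ne hsupp hone h
      exact one_le_dyadicShell_add_self h1 h2
    refine (lintegral_mono hle).trans ?_
    rw [lintegral_sub_left_eq_self fun y =>
      ENNReal.ofReal (kernelMajorant φ (fun j => dyadicShell j ‖η‖) N y)]
    exact lintegral_kernelMajorant_le φ (fun j => dyadicShell_nonneg j _) (sum_dyadicShell_le N _)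
end

section
/- There exists a constant C > 0, depending only on d and φ, such that for every 0 < ε < 1, every ε-thin set Σ ⊆ ℝ^d, every integer N ≥ 0 and every η ∈ ℝ^d, ∫_Σ |M_N(ξ,η)| dξ ≤ Cε. -/
open MeasureTheory Metric
open scoped RealInnerProductSpace Pointwise ENNReal NNReal Convolution

open Classical in
/-- `ρ(x) = min(1, |x|⁻¹)`, with `ρ(0) = 1`. -/
noncomputable def rho {d : ℕ} (x : EuclideanSpace ℝ (Fin d)) : ℝ :=
  if x = 0 then 1 else min 1 ‖x‖⁻¹

/-- A measurable set `S ⊆ ℝ^d` is `ε`-thin if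
`|S ∩ B(x, ρ(x))| ≤ ε |B(x, ρ(x))|` for every `x`. -/
def IsThin {d : ℕ} (ε : ℝ) (S : Set (EuclideanSpace ℝ (Fin d))) : Prop :=
  MeasurableSet S ∧ ∀ x : EuclideanSpace ℝ (Fin d),
    volume (S ∩ closedBall x (rho x)) ≤ ENNReal.ofReal ε * volume (closedBall x (rho x))

section ThinSets

variable {d : ℕ}

local notation "E" => EuclideanSpace ℝ (Fin d)

lemma rho_pos (x : E) : 0 < rho x := by
  unfold rho
  split_ifs with h
  · exact one_pos
  · exact lt_min one_pos (inv_pos.2 (norm_pos_iff.2 h))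

lemma rho_le_one (x : E) : rho x ≤ 1 := by
  unfold rho
  split_ifs
  exacts [le_rfl, min_le_left _ _]

lemma rho_mul_norm_le (x : E) : rho x * ‖x‖ ≤ 1 := by
  unfold rho
  split_ifs with h
  · simp [h]
  · calc min 1 ‖x‖⁻¹ * ‖x‖ ≤ ‖x‖⁻¹ * ‖x‖ := by gcongr; exact min_le_right _ _
      _ = 1 := inv_mul_cancel₀ (norm_ne_zero_iff.2 h)

/-- If `g` is dominated by `G` at the scale `rho`, then the integral of `g` over an `ε`-thin set
is at most `5 ^ d * ε` times the full integral of `G`. -/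
lemma IsThin.setLIntegral_le {ε : ℝ} {S : Set E} (hS : IsThin ε S) {g G : E → ℝ≥0∞}
    (hgG : ∀ y ξ z : E, dist ξ y ≤ rho y → dist z y ≤ rho y → g ξ ≤ G z) :
    ∫⁻ ξ in S, g ξ ≤ ENNReal.ofReal ε * ENNReal.ofReal (5 ^ d) * ∫⁻ z, G z := by
  obtain ⟨u, -, hdisj, hcov⟩ := Vitali.exists_disjoint_subfamily_covering_enlargement_closedBall
    (Set.univ : Set E) id (fun y => rho y / 5) 1
    (fun y _ => by have := rho_le_one y; linarith) 5 (by norm_num)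
  have hpos : ∀ y : E, 0 < rho y / 5 := fun y => div_pos (rho_pos y) (by norm_num)
  have hcount : u.Countable := hdisj.countable_of_nonempty_interior fun y _ =>
    (nonempty_ball.2 (hpos y)).mono ball_subset_interior_closedBall
  have : Countable u := hcount.to_subtype
  have hsub : S ⊆ ⋃ y : u, S ∩ closedBall (y : E) (rho (y : E)) := by
    intro x hx
    obtain ⟨b, hb, hxb⟩ := hcov x (Set.mem_univ x)
    have := hxb (mem_closedBall_self (hpos x).le)
    rw [mul_div_cancel₀ _ (by norm_num : (5 : ℝ) ≠ 0)] at this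
    exact Set.mem_iUnion.2 ⟨⟨b, hb⟩, hx, this⟩
  have hlocal : ∀ y : E, ∫⁻ ξ in S ∩ closedBall y (rho y), g ξ ≤
      ENNReal.ofReal ε * ENNReal.ofReal (5 ^ d) * ∫⁻ z in closedBall y (rho y / 5), G z := by
    intro y
    obtain ⟨c, hgc, hcG⟩ : ∃ c : ℝ≥0∞, (∀ ξ ∈ closedBall y (rho y), g ξ ≤ c) ∧
        ∀ z ∈ closedBall y (rho y / 5), c ≤ G z :=
      ⟨⨅ z ∈ closedBall y (rho y / 5), G z, fun ξ hξ => le_iInf₂ fun z hz => hgG y ξ z hξ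
        ((mem_closedBall.1 hz).trans (by have := rho_pos y; linarith)), fun z hz => iInf₂_le z hz⟩
    have hc : c * volume (closedBall y (rho y / 5)) ≤ ∫⁻ z in closedBall y (rho y / 5), G z := by
      rw [← setLIntegral_const]
      exact setLIntegral_mono' measurableSet_closedBall hcG
    have hvol : volume (closedBall y (rho y)) =
        ENNReal.ofReal (5 ^ d) * volume (closedBall y (rho y / 5)) := by
      have h := Measure.addHaar_closedBall_mul_of_pos volume y (r := 5) (by norm_num) (rho y / 5)
      rw [mul_div_cancel₀ _ (by norm_num : (5 : ℝ) ≠ 0), finrank_euclideanSpace_fin] at h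
      rw [h, Measure.addHaar_closedBall_center volume y]
    calc ∫⁻ ξ in S ∩ closedBall y (rho y), g ξ
        ≤ ∫⁻ _ in S ∩ closedBall y (rho y), c :=
          setLIntegral_mono' (hS.1.inter measurableSet_closedBall) fun ξ hξ =>
            hgc ξ hξ.2
      _ = c * volume (S ∩ closedBall y (rho y)) := setLIntegral_const _ _
      _ ≤ c * (ENNReal.ofReal ε * volume (closedBall y (rho y))) := by gcongr; exact hS.2 y
      _ = ENNReal.ofReal ε * ENNReal.ofReal (5 ^ d) *
            (c * volume (closedBall y (rho y / 5))) := by rw [hvol]; ring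
      _ ≤ ENNReal.ofReal ε * ENNReal.ofReal (5 ^ d) *
            ∫⁻ z in closedBall y (rho y / 5), G z := by gcongr
  calc ∫⁻ ξ in S, g ξ
      ≤ ∫⁻ ξ in ⋃ y : u, S ∩ closedBall (y : E) (rho (y : E)), g ξ := lintegral_mono_set hsub
    _ ≤ ∑' y : u, ∫⁻ ξ in S ∩ closedBall (y : E) (rho (y : E)), g ξ := lintegral_iUnion_le _ _
    _ ≤ ∑' y : u, ENNReal.ofReal ε * ENNReal.ofReal (5 ^ d) *
          ∫⁻ z in closedBall (y : E) (rho (y : E) / 5), G z :=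
        ENNReal.tsum_le_tsum fun y => hlocal y
    _ = ENNReal.ofReal ε * ENNReal.ofReal (5 ^ d) *
          ∫⁻ z in ⋃ y ∈ u, closedBall y (rho y / 5), G z := by
        rw [ENNReal.tsum_mul_left,
          lintegral_biUnion hcount (fun _ _ => measurableSet_closedBall) (by simpa using hdisj)]
    _ ≤ _ := mul_le_mul_right (setLIntegral_le_lintegral _ _) _

lemma one_add_mul_norm_sub_le {t : ℝ} {η : E} (ht : 0 ≤ t) (htη : t ≤ ‖η‖)
    {y ξ z : E} (hξ : dist ξ y ≤ rho y) (hz : dist z y ≤ rho y) :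
    1 + t * ‖η - z‖ ≤ 9 * (1 + t * ‖η - ξ‖) := by
  have hρ := rho_pos y
  have hξz : ‖ξ - z‖ ≤ 2 * rho y := by
    rw [← dist_eq_norm]
    linarith [dist_triangle_right ξ z y]
  have htri : ‖η - z‖ ≤ ‖η - ξ‖ + ‖ξ - z‖ := norm_sub_le_norm_sub_add_norm_sub _ _ _
  have hξ0 : 0 ≤ t * ‖η - ξ‖ := by positivity
  suffices h : t * rho y ≤ 4 ∨ rho y ≤ ‖η - ξ‖ by
    have h1 := mul_le_mul_of_nonneg_left (htri.trans (add_le_add_right hξz _)) ht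
    rcases h with h | h
    · nlinarith
    · nlinarith [mul_le_mul_of_nonneg_left h ht]
  by_contra! h
  have hy : ‖η‖ ≤ ‖η - ξ‖ + dist ξ y + ‖y‖ := by
    have := norm_add₃_le (a := η - ξ) (b := ξ - y) (c := y)
    rw [dist_eq_norm]
    simpa using this
  have h1 := rho_le_one y
  have h2 := rho_mul_norm_le y
  have h3 : 4 < ‖η‖ * rho y := h.1.trans_le (mul_le_mul_of_nonneg_right htη hρ.le)
  nlinarith [h.2]

lemma lintegral_dilate (t : ℝ) (ht : 0 < t) {F : E → ℝ≥0∞} (hF : Measurable F) (η : E) :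
    ENNReal.ofReal (t ^ d) * ∫⁻ z, F (t • (η - z)) = ∫⁻ z, F z := by
  rw [lintegral_sub_left_eq_self (fun z => F (t • z)) η,
    ← lintegral_map hF (measurable_const_smul t), Measure.map_addHaar_smul volume ht.ne',
    lintegral_smul_measure, finrank_euclideanSpace_fin, smul_eq_mul, ← mul_assoc,
    ← ENNReal.ofReal_mul (by positivity), abs_of_pos (by positivity),
    mul_inv_cancel₀ (by positivity), ENNReal.ofReal_one, one_mul]

lemma exists_schwartz_bound (φ : SchwartzMap E ℂ) :
    ∃ K : ℝ, 0 ≤ K ∧ ∀ x, ‖φ x‖ ≤ K * (1 + ‖x‖) ^ (-((d : ℝ) + 1)) := by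
  have h := SchwartzMap.one_add_le_sup_seminorm_apply (𝕜 := ℝ) (m := (d + 1, 0)) (k := d + 1)
    (n := 0) le_rfl le_rfl φ
  refine ⟨_, ((by positivity : (0 : ℝ) ≤ _).trans (h 0)), fun x => ?_⟩
  have hx := h x
  rw [norm_iteratedFDeriv_zero] at hx
  rw [Real.rpow_neg (by positivity), ← div_eq_mul_inv, le_div_iff₀ (by positivity), mul_comm]
  exact_mod_cast hx

lemma norm_phij (φ : E → ℂ) (j : ℕ) (x : E) :
    ‖phij φ j x‖ = ((2 : ℝ) ^ j) ^ d * ‖φ ((2 : ℝ) ^ j • x)‖ := by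
  simp [phij, pow_mul]

lemma measurable_phij (φ : SchwartzMap E ℂ) (j : ℕ) : Measurable (phij (⇑φ) j) := by
  have := φ.continuous
  unfold phij
  fun_prop

lemma exists_setLIntegral_phij_le (φ : SchwartzMap E ℂ) :
    ∃ B : ℝ, 0 ≤ B ∧ ∀ ε : ℝ, 0 < ε → ∀ S : Set E, IsThin ε S → ∀ (j : ℕ) (η : E),
      (2 : ℝ) ^ j < ‖η‖ → ∫⁻ ξ in S, ‖phij (⇑φ) j (η - ξ)‖ₑ ≤ ENNReal.ofReal (B * ε) := by
  obtain ⟨K, hK, hφ⟩ := exists_schwartz_bound φ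
  set r : ℝ := (d : ℝ) + 1
  have hr : 0 < r := by positivity
  set F : E → ℝ≥0∞ := fun x => ENNReal.ofReal ((1 + ‖x‖) ^ (-r)) with hF
  have hFm : Measurable F := by fun_prop
  have hfin : ∫⁻ x, F x < ∞ := finite_integral_one_add_norm (by simp [r])
  refine ⟨5 ^ d * (K * 9 ^ r) * (∫⁻ x, F x).toReal, by positivity, fun ε hε S hS j η hj => ?_⟩
  set t : ℝ := 2 ^ j
  have ht : 0 < t := by positivity
  have key := hS.setLIntegral_le (g := fun ξ => ‖phij (⇑φ) j (η - ξ)‖ₑ)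
    (G := fun z => ENNReal.ofReal (K * 9 ^ r) * (ENNReal.ofReal (t ^ d) * F (t • (η - z)))) ?_
  · refine key.trans_eq ?_
    rw [lintegral_const_mul _ (by fun_prop), lintegral_const_mul _ (by fun_prop),
      lintegral_dilate t ht hFm, ← ENNReal.ofReal_toReal hfin.ne,
      ← ENNReal.ofReal_mul (by positivity), ← ENNReal.ofReal_mul (by positivity),
      ← ENNReal.ofReal_mul (by positivity), ENNReal.toReal_ofReal (by positivity)]
    congr 1
    ring
  · intro y ξ z hξ hz
    have h9 := one_add_mul_norm_sub_le ht.le hj.le hξ hz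
    have hrp : (1 + t * ‖η - ξ‖) ^ (-r) ≤ 9 ^ r * (1 + t * ‖η - z‖) ^ (-r) := by
      have h := Real.rpow_le_rpow_of_nonpos (z := -r) (by positivity) h9 (by linarith)
      rw [Real.mul_rpow (by norm_num) (by positivity), Real.rpow_neg (by norm_num)] at h
      calc (1 + t * ‖η - ξ‖) ^ (-r) = 9 ^ r * ((9 ^ r)⁻¹ * (1 + t * ‖η - ξ‖) ^ (-r)) := by
            rw [mul_inv_cancel_left₀ (by positivity)]
        _ ≤ _ := by gcongr
    rw [← ofReal_norm, hF, ← ENNReal.ofReal_mul (by positivity),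
      ← ENNReal.ofReal_mul (by positivity)]
    refine ENNReal.ofReal_le_ofReal ?_
    rw [norm_phij]
    have h1 := hφ (t • (η - ξ))
    simp only [norm_smul, Real.norm_of_nonneg ht.le] at h1 ⊢
    calc t ^ d * ‖φ (t • (η - ξ))‖ ≤ t ^ d * (K * (1 + t * ‖η - ξ‖) ^ (-r)) := by gcongr
      _ ≤ t ^ d * (K * (9 ^ r * (1 + t * ‖η - z‖) ^ (-r))) := by gcongr
      _ = _ := by ring

lemma fourierInt_phij_s10 (φ : E → ℂ) (j : ℕ) (η : E) :
    fourierInt (phij φ j) η = fourierInt φ (((2 : ℝ) ^ j)⁻¹ • η) := by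
  unfold fourierInt phij
  congr 1
  have h := Measure.integral_comp_smul (volume : Measure E)
    (fun y => φ y * Complex.exp (-Complex.I * ((⟪y, ((2 : ℝ) ^ j)⁻¹ • η⟫ : ℝ) : ℂ))) ((2 : ℝ) ^ j)
  rw [finrank_euclideanSpace_fin, abs_of_pos (by positivity)] at h
  simp only [real_inner_smul_left, real_inner_smul_right,
    inv_mul_cancel_left₀ (pow_ne_zero j (two_ne_zero (α := ℝ)))] at h ⊢
  simp only [mul_assoc]
  rw [integral_const_mul, h, Complex.real_smul, ← mul_assoc]
  push_cast
  rw [pow_mul, mul_inv_cancel₀ (by simp), one_mul]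

/-- Summation by parts: the kernel is a combination of the `phij φ j`. -/
lemma MN_eq (φ : E → ℂ) (N : ℕ) (ξ η : E) :
    MN φ N ξ η = phij φ N (η - ξ) * (1 - fourierInt (phij φ N) η) +
      ∑ j ∈ Finset.range N, phij φ j (η - ξ) *
        (fourierInt (phij φ (j + 1)) η - fourierInt (phij φ j) η) := by
  induction N with
  | zero => simp [MN]
  | succ N ih =>
    have h : MN φ (N + 1) ξ η = MN φ N ξ η + (phij φ (N + 1) (η - ξ) - phij φ N (η - ξ)) *
        (1 - fourierInt (phij φ (N + 1)) η) := by
      simp [MN, Finset.sum_range_succ _ (N + 1)]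
    rw [h, ih, Finset.sum_range_succ]
    ring

lemma card_filter_dyadic_le (h : ℝ) (N : ℕ) :
    ((Finset.range N).filter fun j : ℕ => (2 : ℝ) ^ j < h ∧ h ≤ 4 * 2 ^ j).card ≤ 2 := by
  set s := (Finset.range N).filter fun j : ℕ => (2 : ℝ) ^ j < h ∧ h ≤ 4 * 2 ^ j
  rcases s.eq_empty_or_nonempty with hs | hs
  · simp [hs]
  · set J := s.min' hs
    have hJ := (Finset.mem_filter.1 (s.min'_mem hs)).2
    have hsub : s ⊆ Finset.Ico J (J + 2) := by
      intro j hj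
      refine Finset.mem_Ico.2 ⟨s.min'_le j hj, ?_⟩
      refine (pow_lt_pow_iff_right₀ (one_lt_two (α := ℝ))).1 ?_
      calc (2 : ℝ) ^ j < h := (Finset.mem_filter.1 hj).2.1
        _ ≤ 4 * 2 ^ J := hJ.2
        _ = 2 ^ (J + 2) := by ring
    simpa using Finset.card_le_card hsub

end ThinSets

/-- There is `C > 0` depending only on `d` and `φ` such that for every
`0 < ε < 1`, every `ε`-thin set `Σ`, every `N ≥ 0` and every `η`,
`∫_Σ |M_N(ξ,η)| dξ ≤ C ε`. -/
theorem stmt10 {d : ℕ} (φ : SchwartzMap (EuclideanSpace ℝ (Fin d)) ℂ)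
    (hrad : ∀ x y : EuclideanSpace ℝ (Fin d), ‖x‖ = ‖y‖ → φ x = φ y)
    (him : ∀ ξ, (fourierInt (⇑φ) ξ).im = 0)
    (hre : ∀ ξ, 0 ≤ (fourierInt (⇑φ) ξ).re ∧ (fourierInt (⇑φ) ξ).re ≤ 1)
    (hsupp : ∀ ξ : EuclideanSpace ℝ (Fin d), 2 < ‖ξ‖ → fourierInt (⇑φ) ξ = 0)
    (hone : ∀ ξ : EuclideanSpace ℝ (Fin d), ‖ξ‖ ≤ 1 → fourierInt (⇑φ) ξ = 1)
    :
    ∃ C : ℝ, 0 < C ∧ ∀ ε : ℝ, 0 < ε → ε < 1 →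
      ∀ Sgm : Set (EuclideanSpace ℝ (Fin d)), IsThin ε Sgm →
      ∀ (N : ℕ) (η : EuclideanSpace ℝ (Fin d)),
        ∫⁻ ξ in Sgm, (‖MN (⇑φ) N ξ η‖₊ : ℝ≥0∞) ≤ ENNReal.ofReal (C * ε) := by
  obtain ⟨B, hB, hphi⟩ := exists_setLIntegral_phij_le φ
  have hnorm : ∀ ξ, fourierInt (⇑φ) ξ = ((fourierInt (⇑φ) ξ).re : ℂ) := fun ξ =>
    Complex.ext (by simp) (by simp [him ξ])
  have hdiff : ∀ (j : ℕ) (η : EuclideanSpace ℝ (Fin d)),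
      ‖1 - fourierInt (phij (⇑φ) j) η‖ₑ ≤ 1 := fun j η => by
    rw [fourierInt_phij_s10, hnorm, ← ofReal_norm, ENNReal.ofReal_le_one,
      ← Complex.ofReal_one, ← Complex.ofReal_sub, Complex.norm_real, Real.norm_eq_abs, abs_le]
    constructor <;> linarith [hre (((2 : ℝ) ^ j)⁻¹ • η)]
  have hdiff' : ∀ (j : ℕ) (η : EuclideanSpace ℝ (Fin d)),
      ‖fourierInt (phij (⇑φ) (j + 1)) η - fourierInt (phij (⇑φ) j) η‖ₑ ≤ 1 := fun j η => by
    rw [fourierInt_phij_s10, fourierInt_phij_s10, hnorm, hnorm (((2 : ℝ) ^ j)⁻¹ • η),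
      ← ofReal_norm, ENNReal.ofReal_le_one,
      ← Complex.ofReal_sub, Complex.norm_real, Real.norm_eq_abs, abs_le]
    constructor <;>
      linarith [hre (((2 : ℝ) ^ j)⁻¹ • η), hre (((2 : ℝ) ^ (j + 1))⁻¹ • η)]
  have hlow : ∀ (j : ℕ) (η : EuclideanSpace ℝ (Fin d)), ‖η‖ ≤ 2 ^ j →
      fourierInt (phij (⇑φ) j) η = 1 := fun j η h => by
    rw [fourierInt_phij_s10]
    refine hone _ ?_
    rw [norm_smul, norm_inv, Real.norm_of_nonneg (by positivity), inv_mul_le_iff₀ (by positivity)]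
    simpa using h
  have hhigh : ∀ (j : ℕ) (η : EuclideanSpace ℝ (Fin d)), 2 * 2 ^ j < ‖η‖ →
      fourierInt (phij (⇑φ) j) η = 0 := fun j η h => by
    rw [fourierInt_phij_s10]
    refine hsupp _ ?_
    rw [norm_smul, norm_inv, Real.norm_of_nonneg (by positivity), lt_inv_mul_iff₀ (by positivity)]
    linarith
  refine ⟨3 * B + 1, by positivity, fun ε hε _ S hS N η => ?_⟩
  have hmeas : ∀ j, Measurable fun ξ => phij (⇑φ) j (η - ξ) := fun j =>
    (measurable_phij φ j).comp (measurable_const.sub measurable_id)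
  set b := ENNReal.ofReal (B * ε)
  set s := (Finset.range N).filter fun j : ℕ => (2 : ℝ) ^ j < ‖η‖ ∧ ‖η‖ ≤ 4 * 2 ^ j
  have hterm : ∀ (j : ℕ) (c : ℂ), ‖c‖ₑ ≤ 1 → (c ≠ 0 → (2 : ℝ) ^ j < ‖η‖) →
      ∫⁻ ξ in S, ‖phij (⇑φ) j (η - ξ) * c‖ₑ ≤ b := fun j c hc hc0 => by
    rcases eq_or_ne c 0 with rfl | hne
    · simp
    · refine le_trans (lintegral_mono fun ξ => ?_) (hphi ε hε S hS j η (hc0 hne))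
      rw [enorm_mul]
      exact mul_le_of_le_one_right' hc
  have hMN : ∀ ξ, (‖MN (⇑φ) N ξ η‖₊ : ℝ≥0∞) ≤
      ‖phij (⇑φ) N (η - ξ) * (1 - fourierInt (phij (⇑φ) N) η)‖ₑ +
      ∑ j ∈ s, ‖phij (⇑φ) j (η - ξ) *
        (fourierInt (phij (⇑φ) (j + 1)) η - fourierInt (phij (⇑φ) j) η)‖ₑ := fun ξ => by
    rw [MN_eq, ← Finset.sum_subset (Finset.filter_subset _ _ : s ⊆ Finset.range N)]
    · exact (enorm_add_le _ _).trans (add_le_add_right (enorm_sum_le _ _) _)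
    · intro j hj hjs
      have hor : ‖η‖ ≤ 2 ^ j ∨ 4 * 2 ^ j < ‖η‖ := by
        by_contra! h
        exact hjs (Finset.mem_filter.2 ⟨hj, h⟩)
      rcases hor with h | h
      · rw [hlow j η h, hlow (j + 1) η (h.trans (pow_le_pow_right₀ one_le_two j.le_succ)),
          sub_self, mul_zero]
      · have h2 : (0 : ℝ) < 2 ^ j := by positivity
        rw [hhigh j η (by linarith), hhigh (j + 1) η (by rw [pow_succ]; linarith),
          sub_self, mul_zero]
  calc ∫⁻ ξ in S, (‖MN (⇑φ) N ξ η‖₊ : ℝ≥0∞)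
      ≤ _ := lintegral_mono hMN
    _ = (∫⁻ ξ in S, ‖phij (⇑φ) N (η - ξ) * (1 - fourierInt (phij (⇑φ) N) η)‖ₑ) +
        ∑ j ∈ s, ∫⁻ ξ in S, ‖phij (⇑φ) j (η - ξ) *
          (fourierInt (phij (⇑φ) (j + 1)) η - fourierInt (phij (⇑φ) j) η)‖ₑ := by
        rw [lintegral_add_left ((hmeas N).mul_const _).enorm,
          lintegral_finsetSum _ fun j _ => ((hmeas j).mul_const _).enorm]
    _ ≤ b + ∑ _j ∈ s, b := by
        refine add_le_add (hterm N _ (hdiff N η) fun h => ?_)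
          (Finset.sum_le_sum fun j hj => hterm j _ (hdiff' j η) fun _ =>
            (Finset.mem_filter.1 hj).2.1)
        by_contra! hle
        exact h (by rw [hlow N η hle, sub_self])
    _ ≤ b + 2 * b := by
        rw [Finset.sum_const, nsmul_eq_mul]
        gcongr
        exact Nat.cast_le_ofNat.2 (card_filter_dyadic_le ‖η‖ N)
    _ = ENNReal.ofReal (3 * B * ε) := by
        rw [mul_assoc, ENNReal.ofReal_mul (by norm_num), ENNReal.ofReal_ofNat]
        ring
    _ ≤ _ := ENNReal.ofReal_le_ofReal (by nlinarith)
end
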